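/- Under the standing hypotheses on q, λ, Φ_q, Φ_{q+λ}, W, f, K_c, K_p listed in the context, for every a' < ā₂ the map b ↦ Γ(a', b) attains its maximum over (a', ∞) at exactly one point b' > a'; at this point ∂Γ(a', b)/∂b vanishes, and moreover ρ_{a'}(b') = K_p − K_c and γ(a', b') = 0. -/

import Mathlib

open MeasureTheory Filter Set Real

noncomputable section

/-- Tilted inventory-cost derivative integrand against the scale function:
`ρ_a(b) = ∫_a^b g(y) W(b - y) dy`. -/
def rho (W g : ℝ → ℝ) (a b : ℝ) : ℝ :=
  ∫ y in a..b, g y * W (b - y)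

/-- `Γ(a, b)` of the paper (display (Gamma)). -/
def Gam (lam Phiq Kp Kc : ℝ) (W g : ℝ → ℝ) (a b : ℝ) : ℝ :=
  (∫ y in Set.Ioi (0:ℝ), Real.exp (-Phiq * y) * g (y + a)) +
    lam * (∫ y in (0:ℝ)..(b - a), Real.exp (-Phiq * y) * rho W g a (y + a)) +
    lam / Phiq * Real.exp (-Phiq * (b - a)) * (Kp - Kc)

/-- `Γ₁(a) = Γ(a, a+)`. -/
def Gam1 (lam Phiq Kp Kc : ℝ) (g : ℝ → ℝ) (a : ℝ) : ℝ :=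
  (∫ y in Set.Ioi (0:ℝ), Real.exp (-Phiq * y) * g (y + a)) + lam / Phiq * (Kp - Kc)

/-- `Γ₂(a) = lim_{b→∞} Γ(a,b)/Θ(b-a)`. -/
def Gam2 (Phiql : ℝ) (g : ℝ → ℝ) (a : ℝ) : ℝ :=
  ∫ y in Set.Ioi (0:ℝ), Real.exp (-Phiql * y) * g (y + a)

/-- `Θ(x) = Θ^{(q+λ)}(x, Φ(q))`. -/
def Theta (lam Phiq : ℝ) (W : ℝ → ℝ) (x : ℝ) : ℝ :=
  1 + lam * (∫ y in (0:ℝ)..x, Real.exp (-Phiq * y) * W y)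

/-- `γ(a,b) = -ρ_a(b) + K_p - K_c`. -/
def gam (Kp Kc : ℝ) (W g : ℝ → ℝ) (a b : ℝ) : ℝ :=
  -(rho W g a b) + Kp - Kc

/-- `Z(x) = Z^{(q+λ)}(x) = 1 + (q+λ)∫₀^{x ∨ 0} W(y) dy`. -/
def Zfun (q lam : ℝ) (W : ℝ → ℝ) (x : ℝ) : ℝ :=
  1 + (q + lam) * (∫ y in (0:ℝ)..(max x 0), W y)

/-- Second scale function `Ẑ(x) = Z^{(q+λ)}(x, Φ(q))`. -/
def Zhat (lam Phiq : ℝ) (W : ℝ → ℝ) (x : ℝ) : ℝ :=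
  Real.exp (Phiq * x) *
    (1 + lam * (∫ z in (0:ℝ)..(max x 0), Real.exp (-Phiq * z) * W z))

/-- Translation of an integral over a half-line. -/
theorem setIntegral_Ioi_zero_comp_add (G : ℝ → ℝ) (s : ℝ) :
    ∫ x in Ioi (0:ℝ), G (x + s) = ∫ x in Ioi s, G x := by
  have h := (measurePreserving_add_right volume s).setIntegral_preimage_emb
    (measurableEmbedding_addRight s) G (Ioi s)
  rw [← h]
  simp

theorem integrableOn_Ioi_zero_comp_add (G : ℝ → ℝ) (s : ℝ) :
    IntegrableOn (fun x => G (x + s)) (Ioi 0) ↔ IntegrableOn G (Ioi s) := by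
  have h := (measurePreserving_add_right volume s).integrableOn_comp_preimage
    (measurableEmbedding_addRight s) (f := G) (s := Ioi s)
  rw [← h]
  simp [Function.comp_def]

theorem intervalIntegral_exp_neg_mul {Φ : ℝ} (hΦ : 0 < Φ) (s : ℝ) :
    ∫ w in (0:ℝ)..s, Real.exp (-Φ * w) = (1 - Real.exp (-Φ * s)) / Φ := by
  have h : ∀ x : ℝ, HasDerivAt (fun w => -(Real.exp (-Φ * w)) / Φ) (Real.exp (-Φ * x)) x := by
    intro x
    have := (((hasDerivAt_id x).const_mul (-Φ)).exp.neg).div_const Φ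
    refine this.congr_deriv ?_
    simp only [id]
    field_simp
  rw [intervalIntegral.integral_eq_sub_of_hasDerivAt (fun x _ => h x)
    ((by fun_prop : Continuous fun w => Real.exp (-Φ * w)).intervalIntegrable _ _)]
  simp; ring

/-- A monotone function times a measurable bounded function is interval integrable. -/
theorem Monotone.intervalIntegrable_mul_bdd {v u : ℝ → ℝ} (hv : Monotone v) (hu : Measurable u)
    {C a b : ℝ} (hC : ∀ x ∈ uIoc a b, |u x| ≤ C) :
    IntervalIntegrable (fun y => v y * u y) volume a b := by
  have h1 : IntervalIntegrable v volume a b := hv.intervalIntegrable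
  rw [intervalIntegrable_iff] at h1 ⊢
  refine Integrable.mul_bdd (c := C) h1 hu.aestronglyMeasurable ?_
  exact (ae_restrict_iff' measurableSet_uIoc).2 (ae_of_all _ fun x hx => by simpa using hC x hx)

theorem Monotone.intervalIntegrable_mul_comp_sub {v W : ℝ → ℝ} (hv : Monotone v)
    (hW : Monotone W) (hWnn : ∀ x, 0 ≤ W x) (T a b : ℝ) :
    IntervalIntegrable (fun y => v y * W (T - y)) volume a b := by
  refine hv.intervalIntegrable_mul_bdd (hW.measurable.comp (by fun_prop)) (C := W (T - min a b)) ?_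
  intro x hx
  rw [Function.comp_apply, abs_of_nonneg (hWnn _)]
  exact hW (by linarith [hx.1])

theorem rho_eq_rho_zero (W g : ℝ → ℝ) (a b : ℝ) :
    rho W g a b = rho W (fun y => g (y + a)) 0 (b - a) := by
  have := intervalIntegral.integral_comp_add_right (a := 0) (b := b - a)
    (fun y => g y * W (b - y)) a
  simp only [zero_add, sub_add_cancel] at this
  rw [rho, rho, ← this]
  congr 1; ext y; congr 2; ring

theorem continuousOn_rho {v W : ℝ → ℝ} (hv : Monotone v) (hW : Monotone W)
    (hWnn : ∀ x, 0 ≤ W x) (hWneg : ∀ x < 0, W x = 0) (hWc : ContinuousOn W (Ici 0)) :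
    ContinuousOn (rho W v 0) (Ici 0) := by
  intro T hT
  have hWc' : ∀ x ≠ 0, ContinuousAt W x := by
    intro x hx
    rcases lt_or_gt_of_ne hx with h | h
    · refine (continuousAt_const (y := (0:ℝ))).congr ?_
      filter_upwards [Iio_mem_nhds h] with y hy
      exact (hWneg y hy).symm
    · exact hWc.continuousAt (Ici_mem_nhds h)
  have hcont : ContinuousAt (fun t => ∫ y in (0:ℝ)..(T + 1), v y * W (t - y)) T := by
    refine intervalIntegral.continuousAt_of_dominated_interval
      (bound := fun y => |v y| * W (T + 1)) ?_ ?_ ?_ ?_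
    · refine Eventually.of_forall fun t => ?_
      exact (hv.measurable.mul (hW.measurable.comp (by fun_prop))).aestronglyMeasurable
    · filter_upwards [Iio_mem_nhds (show T < T + 1 by linarith)] with t ht
      refine ae_of_all _ fun y hy => ?_
      rw [uIoc_of_le (by linarith [mem_Ici.1 hT])] at hy
      rw [norm_mul, Real.norm_eq_abs, Real.norm_eq_abs, abs_of_nonneg (hWnn _)]
      exact mul_le_mul_of_nonneg_left (hW (by linarith [hy.1, mem_Iio.1 ht])) (abs_nonneg _)
    · exact (hv.intervalIntegrable.abs).mul_const _
    · have : ∀ᵐ y : ℝ, y ≠ T := by simp [ae_iff]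
      filter_upwards [this] with y hy _
      refine continuousAt_const.mul ?_
      exact ContinuousAt.comp (f := fun t => t - y) (hWc' _ (sub_ne_zero.2 hy.symm)) (by fun_prop)
  have heq : ∀ t ≤ T + 1, rho W v 0 t = ∫ y in (0:ℝ)..(T + 1), v y * W (t - y) := by
    intro t ht
    rw [rho, ← intervalIntegral.integral_add_adjacent_intervals
      (hv.intervalIntegrable_mul_comp_sub hW hWnn t 0 t)
      (hv.intervalIntegrable_mul_comp_sub hW hWnn t t (T + 1)), left_eq_add]
    refine intervalIntegral.integral_zero_ae (ae_of_all _ fun y hy => ?_)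
    rw [uIoc_of_le ht] at hy
    rw [hWneg _ (by linarith [hy.1]), mul_zero]
  refine (hcont.congr ?_).continuousWithinAt
  filter_upwards [Iio_mem_nhds (show T < T + 1 by linarith)] with t ht
  exact (heq t ht.le).symm

section LaplaceShift

variable {Φ : ℝ} {v : ℝ → ℝ}

theorem integrableOn_Ioi_exp_neg_mul_comp_sub
    (hint : IntegrableOn (fun y => Real.exp (-Φ * y) * v y) (Ioi 0)) (h : ℝ) :
    IntegrableOn (fun y => Real.exp (-Φ * y) * v (y - h)) (Ioi h) := by
  rw [← integrableOn_Ioi_zero_comp_add]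
  refine (hint.const_mul (Real.exp (-Φ * h))).congr (ae_of_all _ fun y => ?_)
  simp only [add_sub_cancel_right, mul_add, Real.exp_add]
  ring

theorem setIntegral_Ioi_exp_neg_mul_comp_sub (Φ : ℝ) (v : ℝ → ℝ) (h : ℝ) :
    ∫ y in Ioi h, Real.exp (-Φ * y) * v (y - h)
      = Real.exp (-Φ * h) * ∫ y in Ioi 0, Real.exp (-Φ * y) * v y := by
  rw [← setIntegral_Ioi_zero_comp_add, ← integral_const_mul]
  congr 1; ext y
  simp only [add_sub_cancel_right, mul_add, Real.exp_add]
  ring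

/-- The Laplace transform of the shift of `v` by `h`, extended to `[0, h]` by the value `v 0`. -/
theorem hasIntegral_exp_neg_mul_shift (hΦ : 0 < Φ)
    (hint : IntegrableOn (fun y => Real.exp (-Φ * y) * v y) (Ioi 0)) {h : ℝ} (hh : 0 ≤ h) :
    IntegrableOn (fun y => Real.exp (-Φ * y) * v (max (y - h) 0)) (Ioi 0) ∧
    ∫ y in Ioi 0, Real.exp (-Φ * y) * v (max (y - h) 0)
      = (1 - Real.exp (-Φ * h)) / Φ * v 0
        + Real.exp (-Φ * h) * ∫ y in Ioi 0, Real.exp (-Φ * y) * v y := by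
  have e1 : EqOn (fun y => Real.exp (-Φ * y) * v 0)
      (fun y => Real.exp (-Φ * y) * v (max (y - h) 0)) (Ioc 0 h) := by
    intro y hy
    simp only [max_eq_right (sub_nonpos.2 hy.2)]
  have e2 : EqOn (fun y => Real.exp (-Φ * y) * v (y - h))
      (fun y => Real.exp (-Φ * y) * v (max (y - h) 0)) (Ioi h) := by
    intro y hy
    simp only [max_eq_left (sub_nonneg.2 (mem_Ioi.1 hy).le)]
  have i1 : IntegrableOn (fun y => Real.exp (-Φ * y) * v (max (y - h) 0)) (Ioc 0 h) := by
    refine IntegrableOn.congr_fun ?_ e1 measurableSet_Ioc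
    exact (by fun_prop : Continuous fun y => Real.exp (-Φ * y) * v 0).integrableOn_Ioc
  have i2 := (integrableOn_Ioi_exp_neg_mul_comp_sub hint h).congr_fun e2 measurableSet_Ioi
  rw [← Ioc_union_Ioi_eq_Ioi hh]
  refine ⟨i1.union i2, ?_⟩
  rw [setIntegral_union Ioc_disjoint_Ioi_same measurableSet_Ioi i1 i2,
    ← setIntegral_congr_fun measurableSet_Ioc e1, ← setIntegral_congr_fun measurableSet_Ioi e2,
    Ioc_union_Ioi_eq_Ioi hh, setIntegral_Ioi_exp_neg_mul_comp_sub, integral_mul_const,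
    ← intervalIntegral.integral_of_le hh, intervalIntegral_exp_neg_mul hΦ]

theorem exp_neg_laplace_le (hΦ : 0 < Φ) (hv : Monotone v)
    (hint : IntegrableOn (fun y => Real.exp (-Φ * y) * v y) (Ioi 0)) :
    v 0 ≤ Φ * ∫ y in Ioi 0, Real.exp (-Φ * y) * v y := by
  have h1 : ∫ y in Ioi (0:ℝ), Real.exp (-Φ * y) * v 0 = v 0 / Φ := by
    rw [integral_mul_const, integral_exp_mul_Ioi (by linarith) 0]
    simp; field_simp
  have h2 : ∫ y in Ioi (0:ℝ), Real.exp (-Φ * y) * v 0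
      ≤ ∫ y in Ioi 0, Real.exp (-Φ * y) * v y := by
    refine setIntegral_mono_on ?_ hint measurableSet_Ioi fun y hy => ?_
    · exact (integrableOn_exp_mul_Ioi (by linarith) 0).mul_const _
    · exact mul_le_mul_of_nonneg_left (hv (mem_Ioi.1 hy).le) (Real.exp_pos _).le
  rw [h1, div_le_iff₀ hΦ] at h2
  linarith

end LaplaceShift

/-- The increments of `rho W v 0` are controlled by the Laplace transform of `v`. -/
theorem rho_add_sub_le {Φ : ℝ} (hΦ : 0 < Φ) {v W : ℝ → ℝ} (hv : Monotone v) (hW : Monotone W)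
    (hWnn : ∀ x, 0 ≤ W x)
    (hexp : ∀ T w, 0 < w → w < T → W (T - w) ≤ Real.exp (-Φ * w) * W T)
    (hint : IntegrableOn (fun y => Real.exp (-Φ * y) * v y) (Ioi 0)) (hv0 : v 0 ≤ 0)
    {x h : ℝ} (hx : 0 ≤ x) (hh : 0 < h) :
    rho W v 0 (x + h) - rho W v 0 x
      ≤ h * (v 0 * W x + W (x + h) * (Φ * (∫ y in Ioi 0, Real.exp (-Φ * y) * v y) - v 0)) := by
  set n : ℝ → ℝ := fun w => v (max (w - h) 0) with hn
  have hnm : Monotone n := fun a b hab => hv (max_le_max (by linarith) le_rfl)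
  have hnv : ∀ w, 0 ≤ w → n w ≤ v w := fun w hw => hv (max_le (by linarith) hw)
  obtain ⟨nint, nval⟩ := hasIntegral_exp_neg_mul_shift hΦ hint hh.le
  have ii : ∀ {u : ℝ → ℝ}, Monotone u → ∀ a b,
      IntervalIntegrable (fun w => u w * W (x + h - w)) volume a b :=
    fun hu a b => hu.intervalIntegrable_mul_comp_sub hW hWnn _ a b
  have shifted : ∫ w in (0:ℝ)..(x + h), n w * W (x + h - w)
      ≤ v 0 * (h * W x) + rho W v 0 x := by
    rw [← intervalIntegral.integral_add_adjacent_intervals (ii hnm 0 h) (ii hnm h (x + h))]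
    refine add_le_add ?_ (le_of_eq ?_)
    · have : ∫ w in (0:ℝ)..h, n w * W (x + h - w) ≤ ∫ w in (0:ℝ)..h, v 0 * W x := by
        refine intervalIntegral.integral_mono_on hh.le (ii hnm 0 h)
          intervalIntegrable_const fun w hw => ?_
        simp only [hn, max_eq_right (sub_nonpos.2 hw.2)]
        exact mul_le_mul_of_nonpos_left (hW (by linarith [hw.2])) hv0
      refine this.trans (le_of_eq ?_)
      simp
    · have := intervalIntegral.integral_comp_sub_right (a := h) (b := x + h)
        (fun y => v y * W (x - y)) h
      simp only [sub_self, add_sub_cancel_right] at this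
      rw [rho, ← this]
      refine intervalIntegral.integral_congr fun w hw => ?_
      rw [uIcc_of_le (by linarith)] at hw
      simp only [hn, max_eq_left (sub_nonneg.2 hw.1)]
      congr 2; ring
  have gap : ∫ w in (0:ℝ)..(x + h), (v w * W (x + h - w) - n w * W (x + h - w))
      ≤ W (x + h) * ∫ w in Ioi 0,
        (Real.exp (-Φ * w) * v w - Real.exp (-Φ * w) * v (max (w - h) 0)) := by
    have hpos : ∀ w ∈ Ioi (0:ℝ),
        0 ≤ Real.exp (-Φ * w) * v w - Real.exp (-Φ * w) * v (max (w - h) 0) := by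
      intro w hw
      rw [← mul_sub]
      exact mul_nonneg (Real.exp_pos _).le (sub_nonneg.2 (hnv w (mem_Ioi.1 hw).le))
    rw [← integral_const_mul, intervalIntegral.integral_of_le (by linarith),
      integral_Ioc_eq_integral_Ioo]
    refine le_trans ?_ (setIntegral_mono_set ((hint.sub nint).const_mul (W (x + h))) ?_
      (s := Ioo 0 (x + h)) (Ioo_subset_Ioi_self.eventuallyLE))
    · refine setIntegral_mono_on ?_ ?_ measurableSet_Ioo fun w hw => ?_
      · have := ((ii hv 0 (x + h)).sub (ii hnm 0 (x + h)))
        rw [intervalIntegrable_iff_integrableOn_Ioo_of_le (by linarith)] at this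
        exact this
      · exact IntegrableOn.mono_set ((hint.sub nint).const_mul (W (x + h))) Ioo_subset_Ioi_self
      · have h1 := hexp (x + h) w hw.1 hw.2
        have h2 := hnv w hw.1.le
        simp only [hn] at h2 ⊢
        nlinarith [mul_le_mul_of_nonneg_left h1 (sub_nonneg.2 h2)]
    · exact (ae_restrict_iff' measurableSet_Ioi).2
        (ae_of_all _ fun w hw => mul_nonneg (hWnn _) (hpos w hw))
  rw [intervalIntegral.integral_sub (ii hv _ _) (ii hnm _ _), integral_sub hint nint, nval] at gap
  have hle := exp_neg_laplace_le hΦ hv hint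
  set L := ∫ y in Ioi 0, Real.exp (-Φ * y) * v y with hL
  have hbound : L - ((1 - Real.exp (-Φ * h)) / Φ * v 0 + Real.exp (-Φ * h) * L)
      ≤ h * (Φ * L - v 0) := by
    have e1 : L - ((1 - Real.exp (-Φ * h)) / Φ * v 0 + Real.exp (-Φ * h) * L)
        = (1 - Real.exp (-Φ * h)) / Φ * (Φ * L - v 0) := by field_simp; ring
    rw [e1]
    refine mul_le_mul_of_nonneg_right ?_ (by linarith)
    rw [div_le_iff₀ hΦ]
    linarith [Real.add_one_le_exp (-Φ * h)]
  have hfin := mul_le_mul_of_nonneg_left hbound (hWnn (x + h))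
  have : rho W v 0 (x + h) = ∫ w in (0:ℝ)..(x + h), v w * W (x + h - w) := rfl
  rw [this]
  linarith

/-- If the Laplace transform of `v` at `Φ` is negative, `rho W v 0` decays at least linearly. -/
theorem rho_le_sub_linear {Φ : ℝ} (hΦ : 0 < Φ) {v W : ℝ → ℝ} (hv : Monotone v) (hW : Monotone W)
    (hWnn : ∀ x, 0 ≤ W x) (hWneg : ∀ x < 0, W x = 0) (hWpos : ∀ x > 0, 0 < W x)
    (hWc : ContinuousOn W (Ici 0))
    (hexp : ∀ T w, 0 < w → w < T → W (T - w) ≤ Real.exp (-Φ * w) * W T)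
    (hint : IntegrableOn (fun y => Real.exp (-Φ * y) * v y) (Ioi 0))
    (hneg : ∫ y in Ioi 0, Real.exp (-Φ * y) * v y < 0) {x₀ x : ℝ} (hx₀ : 0 < x₀) (hx : x₀ ≤ x) :
    rho W v 0 x ≤ rho W v 0 x₀
      + Φ * (∫ y in Ioi 0, Real.exp (-Φ * y) * v y) * W x₀ / 2 * (x - x₀) := by
  set L := ∫ y in Ioi 0, Real.exp (-Φ * y) * v y with hL
  have hle : v 0 ≤ Φ * L := exp_neg_laplace_le hΦ hv hint
  have hΦL : Φ * L < 0 := mul_neg_of_pos_of_neg hΦ hneg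
  refine image_le_of_liminf_slope_right_lt_deriv_boundary (a := x₀) (b := x)
    (B := fun t => rho W v 0 x₀ + Φ * L * W x₀ / 2 * (t - x₀))
    (f' := fun t => Φ * L * W t) (B' := fun _ => Φ * L * W x₀ / 2)
    ((continuousOn_rho hv hW hWnn hWneg hWc).mono fun t ht => hx₀.le.trans ht.1) ?_ ?_ ?_ ?_
    (right_mem_Icc.2 hx)
  · intro t ht r hr
    have ht0 : 0 < t := hx₀.trans_le ht.1
    have hWt : ContinuousAt W t := hWc.continuousAt (Ici_mem_nhds ht0)
    have hlim : Tendsto (fun z => v 0 * W t + W z * (Φ * L - v 0)) (nhdsWithin t (Ioi t))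
        (nhds (Φ * L * W t)) := by
      have : ContinuousAt (fun z => v 0 * W t + W z * (Φ * L - v 0)) t := by fun_prop
      have h2 := this.tendsto.mono_left (nhdsWithin_le_nhds (s := Ioi t))
      convert h2 using 2
      ring
    refine Eventually.frequently ?_
    filter_upwards [hlim.eventually_lt_const hr, self_mem_nhdsWithin] with z hz htz
    have htz' : 0 < z - t := sub_pos.2 htz
    have h := rho_add_sub_le hΦ hv hW hWnn hexp hint (by linarith) ht0.le htz'
    rw [add_sub_cancel] at h
    rw [slope_def_field, div_lt_iff₀ htz']
    refine h.trans_lt ?_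
    rw [mul_comm]
    exact mul_lt_mul_of_pos_right hz htz'
  · simp
  · intro t
    have := (((hasDerivAt_id t).sub_const x₀).const_mul (Φ * L * W x₀ / 2)).const_add (rho W v 0 x₀)
    simpa using this
  · intro t ht _
    have h1 : W x₀ ≤ W t := hW ht.1
    have h2 := hWpos x₀ hx₀
    nlinarith

/-- A function whose derivative is a positive multiple of a strictly decreasing function minus
one of its values has a unique maximizer. -/
theorem isMaxOn_Ioi_iff_of_deriv_strictAntiOn {F R k : ℝ → ℝ} {a c b₀ : ℝ}
    (hk : ∀ b > a, 0 < k b) (hF : ∀ b > a, HasDerivAt F (k b * (R b - c)) b)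
    (hR : StrictAntiOn R (Ioi a)) (hb₀ : a < b₀) (hRb₀ : R b₀ = c) (b : ℝ) (hb : a < b) :
    IsMaxOn F (Ioi a) b ↔ b = b₀ := by
  have hcont : ContinuousOn F (Ioi a) := fun b hb => (hF b hb).continuousAt.continuousWithinAt
  have hmono : StrictMonoOn F (Ioc a b₀) := by
    refine strictMonoOn_of_deriv_pos (convex_Ioc a b₀) (hcont.mono Ioc_subset_Ioi_self) ?_
    rw [interior_Ioc]
    intro x hx
    rw [(hF x hx.1).deriv]
    have := hR (mem_Ioi.2 hx.1) (mem_Ioi.2 hb₀) hx.2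
    exact mul_pos (hk x hx.1) (by linarith)
  have hanti : StrictAntiOn F (Ici b₀) := by
    refine strictAntiOn_of_deriv_neg (convex_Ici b₀)
      (hcont.mono fun t ht => hb₀.trans_le ht) ?_
    rw [interior_Ici]
    intro x hx
    have hax : a < x := hb₀.trans hx
    rw [(hF x hax).deriv]
    have := hR (mem_Ioi.2 hb₀) (mem_Ioi.2 hax) hx
    exact mul_neg_of_pos_of_neg (hk x hax) (by linarith)
  have hlt : ∀ x > a, x ≠ b₀ → F x < F b₀ := by
    intro x hx hne
    rcases lt_or_gt_of_ne hne with h | h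
    · exact hmono ⟨hx, h.le⟩ ⟨hb₀, le_rfl⟩ h
    · exact hanti self_mem_Ici h.le h
  constructor
  · intro hmax
    by_contra hne
    exact absurd (hmax (mem_Ioi.2 hb₀)) (not_le.2 (hlt b hb hne))
  · rintro rfl x hx
    rcases eq_or_ne x b with rfl | hne
    · exact le_refl (F x)
    · exact (hlt x hx hne).le

theorem hasDerivAt_Gam {lam Phiq Kp Kc : ℝ} (hPhiq : Phiq ≠ 0) {W g : ℝ → ℝ} {a b : ℝ}
    (hρ : ContinuousOn (rho W g a) (Ici a)) (hb : a < b) :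
    HasDerivAt (fun b => Gam lam Phiq Kp Kc W g a b)
      (lam * Real.exp (-Phiq * (b - a)) * (rho W g a b - (Kp - Kc))) b := by
  have hc : ContinuousOn (fun y => Real.exp (-Phiq * y) * rho W g a (y + a)) (Ici 0) := by
    refine ContinuousOn.mul (by fun_prop) ?_
    exact hρ.comp (by fun_prop) fun y hy => by simpa using hy
  have hba : 0 < b - a := sub_pos.2 hb
  have h1 : HasDerivAt (fun x => ∫ y in (0:ℝ)..x, Real.exp (-Phiq * y) * rho W g a (y + a))
      (Real.exp (-Phiq * (b - a)) * rho W g a (b - a + a)) (b - a) := by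
    refine intervalIntegral.integral_hasDerivAt_right ?_ ?_ (hc.continuousAt (Ici_mem_nhds hba))
    · refine (hc.mono ?_).intervalIntegrable
      rw [uIcc_of_le hba.le]
      exact Icc_subset_Ici_self
    · exact (hc.mono Ioi_subset_Ici_self).stronglyMeasurableAtFilter isOpen_Ioi _ hba
  have hsub : HasDerivAt (fun b => b - a) 1 b := (hasDerivAt_id b).sub_const a
  have h2 := (h1.comp b hsub).const_mul lam
  have h3 := (((hsub.const_mul (-Phiq)).exp).const_mul (lam / Phiq)).mul_const (Kp - Kc)
  refine ((h2.const_add (∫ y in Ioi (0:ℝ), Real.exp (-Phiq * y) * g (y + a))).add h3).congr_deriv ?_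
  rw [sub_add_cancel]
  field_simp
  ring

/-- The Laplace transform of a shifted increasing function is negative for far left shifts. -/
theorem bddBelow_setOf_Gam2_nonneg {Φ : ℝ} (hΦ : 0 < Φ) {g : ℝ → ℝ} (hg : Monotone g)
    (hint : ∀ a, IntegrableOn (fun y => Real.exp (-Φ * y) * g (y + a)) (Ioi 0))
    {m : ℝ} (hm : g m < 0) : BddBelow {a | 0 ≤ Gam2 Φ g a} := by
  have hbound : ∀ s, 0 ≤ s → Gam2 Φ g (m - s)
      ≤ g m * ((1 - Real.exp (-Φ * s)) / Φ) + Real.exp (-Φ * s) * Gam2 Φ g m := by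
    intro s hs
    have hi := hint (m - s)
    have hshift := setIntegral_Ioi_exp_neg_mul_comp_sub Φ (fun y => g (y + m)) s
    simp only [sub_add_eq_add_sub] at hshift
    rw [Gam2, Gam2, ← hshift, ← Ioc_union_Ioi_eq_Ioi hs,
      setIntegral_union Ioc_disjoint_Ioi_same measurableSet_Ioi (hi.mono_set Ioc_subset_Ioi_self)
      (hi.mono_set (Ioi_subset_Ioi hs))]
    refine add_le_add ?_ (le_of_eq ?_)
    · rw [← intervalIntegral_exp_neg_mul hΦ, ← intervalIntegral.integral_const_mul,
        intervalIntegral.integral_of_le hs]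
      refine setIntegral_mono_on (hi.mono_set Ioc_subset_Ioi_self) ?_ measurableSet_Ioc ?_
      · exact (by fun_prop : Continuous fun y => g m * Real.exp (-Φ * y)).integrableOn_Ioc
      · intro y hy
        rw [mul_comm]
        exact mul_le_mul_of_nonneg_right (hg (by linarith [hy.2])) (Real.exp_pos _).le
    · simp only [add_sub_assoc]
  have hexp : Tendsto (fun s => Real.exp (-Φ * s)) atTop (nhds 0) :=
    Real.tendsto_exp_atBot.comp (tendsto_id.const_mul_atTop_of_neg (by linarith))
  have hlim : Tendsto (fun s => g m * ((1 - Real.exp (-Φ * s)) / Φ)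
      + Real.exp (-Φ * s) * Gam2 Φ g m) atTop (nhds (g m * ((1 - 0) / Φ) + 0 * Gam2 Φ g m)) :=
    (((hexp.const_sub 1).div_const Φ).const_mul (g m)).add (hexp.mul_const _)
  have hneg : g m * ((1 - 0) / Φ) + 0 * Gam2 Φ g m < 0 := by
    rw [zero_mul, add_zero]
    exact mul_neg_of_neg_of_pos hm (by simpa using hΦ)
  obtain ⟨S, hS⟩ := eventually_atTop.1 (hlim.eventually_lt_const hneg)
  refine ⟨m - max S 0, fun a ha => ?_⟩
  by_contra! hlt
  have hs : max S 0 ≤ m - a := by linarith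
  have h1 := hbound (m - a) ((le_max_right _ _).trans hs)
  have h2 := hS (m - a) ((le_max_left _ _).trans hs)
  rw [sub_sub_cancel] at h1
  exact absurd (mem_ofPred.1 ha) (not_le.2 (h1.trans_lt h2))

theorem ConvexOn.monotone_of_hasDerivWithinAt_Ici {f f' : ℝ → ℝ} (hf : ConvexOn ℝ univ f)
    (hf' : ∀ x, HasDerivWithinAt f (f' x) (Ici x) x) : Monotone f' := by
  have h : ∀ x, derivWithin f (Ioi x) x = f' x := fun x =>
    (hf' x).Ioi_of_Ici.derivWithin (uniqueDiffWithinAt_Ioi x)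
  intro x y hxy
  have := hf.monotoneOn_rightDeriv (a := x) (by simp) (b := y) (by simp) hxy
  simpa only [h] using this

/-- The right derivative of a convex function of polynomial growth grows subexponentially. -/
theorem ConvexOn.isBigO_exp_of_hasDerivWithinAt_Ici {f f' : ℝ → ℝ} (hf : ConvexOn ℝ univ f)
    (hf' : ∀ x, HasDerivWithinAt f (f' x) (Ici x) x) {C M : ℝ} {N : ℕ}
    (hgrowth : ∀ x, M < |x| → |f x| ≤ C * |x| ^ N) {b : ℝ} (hb : 0 < b) :
    f' =O[atTop] fun x => Real.exp (b * x) := by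
  have hfO : f =O[atTop] fun x => Real.exp (b * x) := by
    have h1 : f =O[atTop] fun x : ℝ => x ^ N := by
      refine Asymptotics.IsBigO.of_bound C ?_
      filter_upwards [eventually_gt_atTop M] with x hx
      simpa using hgrowth x (hx.trans_le (le_abs_self x))
    exact h1.trans (isLittleO_pow_exp_pos_mul_atTop N hb).isBigO
  have hfO1 : (fun x => f (x + 1)) =O[atTop] fun x => Real.exp (b * x) := by
    have h1 := hfO.comp_tendsto (tendsto_atTop_add_const_right atTop (1:ℝ) tendsto_id)
    refine h1.trans ?_
    simp only [Function.comp_def, id, mul_add, Real.exp_add]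
    simpa only [mul_comm] using Asymptotics.isBigO_const_mul_self (Real.exp (b * 1))
      (fun x => Real.exp (b * x)) atTop
  have hone : (fun _ : ℝ => f' 0) =O[atTop] fun x => Real.exp (b * x) := by
    refine Asymptotics.IsBigO.of_bound |f' 0| ?_
    filter_upwards [eventually_ge_atTop 0] with x hx
    rw [Real.norm_eq_abs, Real.norm_eq_abs, abs_of_pos (Real.exp_pos _)]
    exact le_mul_of_one_le_right (abs_nonneg _) (Real.one_le_exp (by positivity))
  refine Asymptotics.IsBigO.trans ?_ (hone.norm_left.add (hfO1.sub hfO).norm_left)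
  refine Asymptotics.IsBigO.of_bound 1 ?_
  filter_upwards [eventually_ge_atTop 0] with x hx
  have h1 : f' 0 ≤ f' x := hf.monotone_of_hasDerivWithinAt_Ici hf' hx
  have h2 : f' x ≤ f (x + 1) - f x := by
    have := hf.le_slope_of_hasDerivWithinAt_Ioi (mem_univ x) (mem_univ (x + 1)) (by linarith)
      (hf' x).Ioi_of_Ici
    simpa [slope_def_field] using this
  rw [one_mul, Real.norm_eq_abs (‖f' 0‖ + _), abs_of_nonneg (by positivity)]
  simp only [Real.norm_eq_abs]
  refine abs_le.2 ⟨?_, ?_⟩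
  · linarith [neg_abs_le (f' 0), abs_nonneg (f (x + 1) - f x)]
  · linarith [le_abs_self (f (x + 1) - f x), abs_nonneg (f' 0)]

theorem Monotone.integrableOn_exp_neg_mul {v : ℝ → ℝ} (hv : Monotone v) {b Φ : ℝ} (hb : b < Φ)
    (hO : v =O[atTop] fun x => Real.exp (b * x)) (s : ℝ) :
    IntegrableOn (fun y => Real.exp (-Φ * y) * v y) (Ioi s) := by
  have hloc : LocallyIntegrable (fun y => Real.exp (-Φ * y) * v y) :=
    hv.locallyIntegrable.continuous_mul (by fun_prop)
  have hO' : (fun y => Real.exp (-Φ * y) * v y) =O[atTop] fun y => Real.exp ((b - Φ) * y) := by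
    refine ((Asymptotics.isBigO_refl (fun y => Real.exp (-Φ * y)) atTop).mul hO).congr_right ?_
    intro y
    rw [← Real.exp_add]
    ring_nf
  exact ((hloc.locallyIntegrableOn _).integrableOn_of_isBigO_atTop hO'
    ⟨Ioi s, Ioi_mem_atTop s, integrableOn_exp_mul_Ioi (by linarith) s⟩).mono_set Ioi_subset_Ici_self

/-- Corollary 5.4 (critical point) of the paper. -/
theorem critical_point
    (q lam Phiq Phiql : ℝ) (hq : 0 < q) (hlam : 0 < lam)
    (hPhiq : 0 < Phiq) (hPhi : Phiq < Phiql)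
    (W : ℝ → ℝ)
    (hW0 : ∀ x < (0:ℝ), W x = 0)
    (hWnn : ∀ x ≥ (0:ℝ), 0 ≤ W x)
    (hWcont : ContinuousOn W (Set.Ici 0))
    (hWmono : StrictMonoOn W (Set.Ici 0))
    (hWC1 : ContDiffOn ℝ 1 W (Set.Ioi 0))
    (hWratio_mono : ∀ a y : ℝ, a < y →
      MonotoneOn (fun b => W (b - y) / W (b - a)) (Set.Ioi y))
    (hWratio_lim : ∀ a y : ℝ, a < y →
      Filter.Tendsto (fun b => W (b - y) / W (b - a)) Filter.atTop
        (nhds (Real.exp (-Phiql * (y - a)))))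
    (hWasymp : ∃ L : ℝ, 0 < L ∧
      Filter.Tendsto (fun x => Real.exp (-Phiql * x) * W x) Filter.atTop (nhds L))
    (f f' : ℝ → ℝ)
    (hf_conv : ConvexOn ℝ Set.univ f)
    (hf_deriv : ∀ x : ℝ, HasDerivWithinAt f (f' x) (Set.Ici x) x)
    (hf_pw : ∃ E : Set ℝ, E.Countable ∧ ∀ x ∉ E, ContinuousAt f' x)
    (hf_growth : ∃ C M : ℝ, ∃ N : ℕ, 0 < C ∧ 0 < M ∧
      ∀ x : ℝ, M < |x| → |f x| ≤ C * |x| ^ N)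
    (Kc Kp : ℝ) (hK : Kp < Kc)
    (g : ℝ → ℝ) (hg : ∀ x : ℝ, g x = f' x + q * Kc + lam * (Kc - Kp))
    (habar_ne : {a : ℝ | 0 ≤ g a}.Nonempty)
    (habar_bdd : BddBelow {a : ℝ | 0 ≤ g a})
    (habb_ne : {a : ℝ | 0 < f' a + q * Kp}.Nonempty)
    (habb_bdd : BddBelow {a : ℝ | 0 < f' a + q * Kp})
    (a2 : ℝ) (ha2 : a2 = sInf {a : ℝ | 0 ≤ Gam2 Phiql g a}) :
    ∀ a' : ℝ, a' < a2 →
      (∃! b' : ℝ, a' < b' ∧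
        IsMaxOn (fun b => Gam lam Phiq Kp Kc W g a' b) (Set.Ioi a') b') ∧
      (∀ b' : ℝ, a' < b' →
        IsMaxOn (fun b => Gam lam Phiq Kp Kc W g a' b) (Set.Ioi a') b' →
          deriv (fun b => Gam lam Phiq Kp Kc W g a' b) b' = 0 ∧
          rho W g a' b' = Kp - Kc ∧
          gam Kp Kc W g a' b' = 0) := by
  have hWnn' : ∀ x, 0 ≤ W x := fun x =>
    (lt_or_ge x 0).elim (fun h => (hW0 x h).ge) (hWnn x)
  have hWm : Monotone W := by
    intro x y hxy
    rcases lt_or_ge x 0 with h | h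
    · rw [hW0 x h]
      exact hWnn' y
    · exact hWmono.monotoneOn h (h.trans hxy) hxy
  have hWpos : ∀ x > 0, 0 < W x := fun x hx =>
    (hWnn 0 le_rfl).trans_lt (hWmono self_mem_Ici hx.le hx)
  have hexp : ∀ T w, 0 < w → w < T → W (T - w) ≤ Real.exp (-Phiql * w) * W T := by
    intro T w hw hT
    rw [← div_le_iff₀ (hWpos T (hw.trans hT))]
    have h := hWratio_lim 0 w hw
    simp only [sub_zero] at h
    refine ge_of_tendsto h ?_
    filter_upwards [eventually_ge_atTop T] with b hb
    simpa using hWratio_mono 0 w hw (mem_Ioi.2 hT) (mem_Ioi.2 (hT.trans_le hb)) hb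
  have hPhiql : 0 < Phiql := hPhiq.trans hPhi
  have hf'm := hf_conv.monotone_of_hasDerivWithinAt_Ici hf_deriv
  have hgm : Monotone g := by
    intro x y hxy
    rw [hg, hg]
    linarith [hf'm hxy]
  obtain ⟨C, M, N, -, -, hgrowth⟩ := hf_growth
  have hint : ∀ a, IntegrableOn (fun y => Real.exp (-Phiql * y) * g (y + a)) (Ioi 0) := by
    intro a
    have h : IntegrableOn (_ + _) (Ioi a) := (hf'm.integrableOn_exp_neg_mul (half_lt_self hPhiql)
      (hf_conv.isBigO_exp_of_hasDerivWithinAt_Ici hf_deriv hgrowth (half_pos hPhiql)) a).add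
      ((integrableOn_exp_mul_Ioi (neg_lt_zero.2 hPhiql) a).mul_const (q * Kc + lam * (Kc - Kp)))
    rw [← integrableOn_Ioi_zero_comp_add] at h
    refine IntegrableOn.congr_fun (Integrable.const_mul h (Real.exp (Phiql * a))) ?_
      measurableSet_Ioi
    intro y _
    have he : Real.exp (Phiql * a) * Real.exp (-Phiql * (y + a)) = Real.exp (-Phiql * y) := by
      rw [← Real.exp_add]
      ring_nf
    simp only [Pi.add_apply, hg, ← he]
    ring
  obtain ⟨l, hl⟩ := habar_bdd
  have hm : g (l - 1) < 0 := by
    by_contra! h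
    linarith [hl (mem_ofPred.2 h)]
  intro a ha
  have hneg : Gam2 Phiql g a < 0 := by
    rw [ha2] at ha
    have := notMem_of_lt_csInf ha (bddBelow_setOf_Gam2_nonneg hPhiql hgm hint hm)
    exact not_le.1 this
  set v : ℝ → ℝ := fun y => g (y + a) with hv_def
  have hv : Monotone v := fun x y hxy => hgm (by linarith)
  have hρv : ∀ b, rho W g a b = rho W v 0 (b - a) := rho_eq_rho_zero W g a
  have hcont : ContinuousOn (rho W g a) (Ici a) := by
    refine ((continuousOn_rho hv hWm hWnn' hW0 hWcont).comp (f := fun b => b - a) (by fun_prop)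
      fun b hb => sub_nonneg.2 (mem_Ici.1 hb)).congr fun b _ => hρv b
  have hdecay : ∀ x y, a < x → x ≤ y → rho W g a y ≤ rho W g a x
      + Phiql * Gam2 Phiql g a * W (x - a) / 2 * (y - x) := by
    intro x y hx hxy
    have := rho_le_sub_linear hPhiql hv hWm hWnn' hW0 hWpos hWcont hexp (hint a) hneg
      (sub_pos.2 hx) (sub_le_sub_right hxy a)
    rw [sub_sub_sub_cancel_right] at this
    rw [hρv, hρv]
    exact this
  have hrate : ∀ x, a < x → Phiql * Gam2 Phiql g a * W (x - a) / 2 < 0 := fun x hx =>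
    div_neg_of_neg_of_pos (mul_neg_of_neg_of_pos (mul_neg_of_pos_of_neg hPhiql hneg)
      (hWpos _ (sub_pos.2 hx))) two_pos
  have hanti : StrictAntiOn (rho W g a) (Ioi a) := by
    intro x hx y _ hxy
    have h := mul_neg_of_neg_of_pos (hrate x hx) (sub_pos.2 hxy)
    linarith [hdecay x y hx hxy.le]
  obtain ⟨b₀, hb₀, hρb₀⟩ : ∃ b, a < b ∧ rho W g a b = Kp - Kc := by
    have hρa : rho W g a a = 0 := intervalIntegral.integral_same
    set κ := Phiql * Gam2 Phiql g a * W (a + 1 - a) / 2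
    have hκ : κ < 0 := hrate (a + 1) (by linarith)
    have hlim : Tendsto (fun y => rho W g a (a + 1) + κ * (y - (a + 1))) atTop atBot :=
      tendsto_atBot_add_const_left _ _
        ((tendsto_atTop_add_const_right atTop (-(a + 1)) tendsto_id).const_mul_atTop_of_neg hκ)
    obtain ⟨y, hy, hya⟩ := ((hlim.eventually_lt_atBot (Kp - Kc)).and
      (eventually_ge_atTop (a + 1))).exists
    have hay : a ≤ y := by linarith
    have hρy := (hdecay (a + 1) y (by linarith) hya).trans_lt hy
    obtain ⟨b, hb, hρb⟩ := intermediate_value_Icc' hay (hcont.mono Icc_subset_Ici_self)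
      (show Kp - Kc ∈ Icc (rho W g a y) (rho W g a a) from ⟨hρy.le, by linarith⟩)
    refine ⟨b, lt_of_le_of_ne hb.1 ?_, hρb⟩
    rintro rfl
    linarith
  have hderiv : ∀ b > a, HasDerivAt (fun b => Gam lam Phiq Kp Kc W g a b)
      (lam * Real.exp (-Phiq * (b - a)) * (rho W g a b - (Kp - Kc))) b :=
    fun b hb => hasDerivAt_Gam hPhiq.ne' hcont hb
  have hiff := isMaxOn_Ioi_iff_of_deriv_strictAntiOn
    (fun b _ => mul_pos hlam (Real.exp_pos _)) hderiv hanti hb₀ hρb₀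
  refine ⟨⟨b₀, ⟨hb₀, (hiff b₀ hb₀).2 rfl⟩, fun b hb => (hiff b hb.1).1 hb.2⟩, ?_⟩
  intro b hb hmax
  obtain rfl := (hiff b hb).1 hmax
  refine ⟨?_, hρb₀, ?_⟩
  · rw [(hderiv b hb).deriv, hρb₀, sub_self, mul_zero]
  · rw [gam, hρb₀]
    ring
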